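/- For any invertible n×n matrix φ over A and all τ₀, τ₁, τ₂, τ₃ ∈ Der: τ₀(p₃(φ)(τ₁,τ₂,τ₃)) − τ₁(p₃(φ)(τ₀,τ₂,τ₃)) + τ₂(p₃(φ)(τ₀,τ₁,τ₃)) − τ₃(p₃(φ)(τ₀,τ₁,τ₂)) − p₃(φ)(⁅τ₀,τ₁⁆,τ₂,τ₃) + p₃(φ)(⁅τ₀,τ₂⁆,τ₁,τ₃) − p₃(φ)(⁅τ₀,τ₃⁆,τ₁,τ₂) − p₃(φ)(⁅τ₁,τ₂⁆,τ₀,τ₃) + p₃(φ)(⁅τ₁,τ₃⁆,τ₀,τ₂) − p₃(φ)(⁅τ₂,τ₃⁆,τ₀,τ₁) = 0. (Section 3.5: the 3-form (1/6)tr{(φ⁻¹dφ)³} is closed, d_DR p₃(φ) = 0, with the de Rham differential given by the Chevalley–Eilenberg formula.) -/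

import Mathlib

noncomputable section

variable (k A : Type*) [Field k] [CharZero k] [CommRing A] [Algebra k A]

/-- Entrywise application of a derivation to a matrix. -/
def dmat {n : ℕ} (τ : Derivation k A A) (φ : Matrix (Fin n) (Fin n) A) :
    Matrix (Fin n) (Fin n) A :=
  Matrix.of fun p q => τ (φ p q)

/-- One half, as an element of `A`. -/
def half : A := algebraMap k A 2⁻¹

/-- `P₂(φ,ψ)(τ,σ) := ½[tr(ψ⁻¹φ⁻¹τ(φ)σ(ψ)) − tr(ψ⁻¹φ⁻¹σ(φ)τ(ψ))]`,
the 2-form `½ tr{ψ⁻¹φ⁻¹ dφ dψ}` evaluated on `(τ,σ)`. -/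
def P2 {n : ℕ} (φ ψ : Matrix (Fin n) (Fin n) A) (τ σ : Derivation k A A) : A :=
  half k A * (Matrix.trace (ψ⁻¹ * φ⁻¹ * dmat k A τ φ * dmat k A σ ψ)
    - Matrix.trace (ψ⁻¹ * φ⁻¹ * dmat k A σ φ * dmat k A τ ψ))

/-- `p₃(φ)(τ₁,τ₂,τ₃) := (1/6)·Σ_{π∈S₃} sgn(π)·tr(N_{π(1)} N_{π(2)} N_{π(3)})`
with `N_i = φ⁻¹·τ_i(φ)`; the 3-form `(1/6)tr{(φ⁻¹dφ)³}` evaluated on `(τ₁,τ₂,τ₃)`. -/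
def p3 {n : ℕ} (φ : Matrix (Fin n) (Fin n) A) (τ₁ τ₂ τ₃ : Derivation k A A) : A :=
  algebraMap k A 6⁻¹ *
    ∑ π : Equiv.Perm (Fin 3), (Equiv.Perm.sign π : ℤ) •
      Matrix.trace ((φ⁻¹ * dmat k A (![τ₁, τ₂, τ₃] (π 0)) φ) *
        (φ⁻¹ * dmat k A (![τ₁, τ₂, τ₃] (π 1)) φ) *
        (φ⁻¹ * dmat k A (![τ₁, τ₂, τ₃] (π 2)) φ))

/-- The cochain `p₂(φ,g)` of Section 3.5 (with `g = g_i`, `h = g_j`), evaluated on `(τ,σ)`. -/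
def Qc {n : ℕ} (φ g h : Matrix (Fin n) (Fin n) A) (τ σ : Derivation k A A) : A :=
  half k A * (Matrix.trace (φ⁻¹ * g⁻¹ * dmat k A τ g * φ * h⁻¹ * dmat k A σ h)
    - Matrix.trace (φ⁻¹ * g⁻¹ * dmat k A σ g * φ * h⁻¹ * dmat k A τ h)
    + Matrix.trace (φ⁻¹ * dmat k A τ φ * h⁻¹ * dmat k A σ h)
    - Matrix.trace (φ⁻¹ * dmat k A σ φ * h⁻¹ * dmat k A τ h)
    - Matrix.trace (g⁻¹ * dmat k A τ g * dmat k A σ φ * φ⁻¹)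
    + Matrix.trace (g⁻¹ * dmat k A σ g * dmat k A τ φ * φ⁻¹))

section

variable {K R : Type*} [Field K] [CommRing R] [Algebra K R] {n : ℕ}

lemma trace_dmat (τ : Derivation K R R) (X : Matrix (Fin n) (Fin n) R) :
    τ X.trace = (dmat K R τ X).trace := by
  simp [Matrix.trace, dmat, map_sum]

lemma dmat_mul (τ : Derivation K R R) (X Y : Matrix (Fin n) (Fin n) R) :
    dmat K R τ (X * Y) = dmat K R τ X * Y + X * dmat K R τ Y := by
  ext i j
  simp only [dmat, Matrix.of_apply, Matrix.mul_apply, Matrix.add_apply, map_sum,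
    Derivation.leibniz, smul_eq_mul, ← Finset.sum_add_distrib]
  exact Finset.sum_congr rfl fun l _ => by ring

lemma dmat_one (τ : Derivation K R R) : dmat K R τ (1 : Matrix (Fin n) (Fin n) R) = 0 := by
  ext i j
  by_cases h : i = j <;> simp [dmat, Matrix.one_apply, h]

lemma dmat_lie (τ σ : Derivation K R R) (X : Matrix (Fin n) (Fin n) R) :
    dmat K R ⁅τ, σ⁆ X = dmat K R τ (dmat K R σ X) - dmat K R σ (dmat K R τ X) := by
  ext i j
  simp [dmat, Derivation.commutator_apply]

lemma dmat_inv (τ : Derivation K R R) {φ : Matrix (Fin n) (Fin n) R} (hφ : IsUnit φ) :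
    dmat K R τ φ⁻¹ = -(φ⁻¹ * dmat K R τ φ * φ⁻¹) := by
  have hdet := (Matrix.isUnit_iff_isUnit_det φ).mp hφ
  have h := dmat_mul τ φ⁻¹ φ
  rw [Matrix.nonsing_inv_mul φ hdet, dmat_one] at h
  calc dmat K R τ φ⁻¹ = dmat K R τ φ⁻¹ * φ * φ⁻¹ := by
        rw [Matrix.mul_assoc, Matrix.mul_nonsing_inv φ hdet, Matrix.mul_one]
    _ = -(φ⁻¹ * dmat K R τ φ * φ⁻¹) := by
        rw [eq_neg_of_add_eq_zero_left h.symm, Matrix.neg_mul]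

/-- The logarithmic derivative `φ⁻¹ τ(φ)`. -/
def logDer (φ : Matrix (Fin n) (Fin n) R) (τ : Derivation K R R) : Matrix (Fin n) (Fin n) R :=
  φ⁻¹ * dmat K R τ φ

/-- The second-order term `φ⁻¹ τ(σ(φ))`. -/
def logDer₂ (φ : Matrix (Fin n) (Fin n) R) (τ σ : Derivation K R R) :
    Matrix (Fin n) (Fin n) R :=
  φ⁻¹ * dmat K R τ (dmat K R σ φ)

lemma dmat_logDer (τ σ : Derivation K R R) {φ : Matrix (Fin n) (Fin n) R} (hφ : IsUnit φ) :
    dmat K R τ (logDer φ σ) = logDer₂ φ τ σ - logDer φ τ * logDer φ σ := by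
  rw [logDer, dmat_mul, dmat_inv τ hφ, logDer₂, logDer]
  noncomm_ring

lemma logDer_lie (φ : Matrix (Fin n) (Fin n) R) (τ σ : Derivation K R R) :
    logDer φ ⁅τ, σ⁆ = logDer₂ φ τ σ - logDer₂ φ σ τ := by
  rw [logDer, dmat_lie, Matrix.mul_sub, logDer₂, logDer₂]

lemma trace_rotate_three (X Y Z : Matrix (Fin n) (Fin n) R) :
    (X * Y * Z).trace = (Y * Z * X).trace := by
  rw [Matrix.mul_assoc, Matrix.trace_mul_comm]

lemma trace_rotate_four (X Y Z W : Matrix (Fin n) (Fin n) R) :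
    (X * Y * Z * W).trace = (Y * Z * W * X).trace := by
  rw [Matrix.mul_assoc, Matrix.mul_assoc, Matrix.trace_mul_comm, ← Matrix.mul_assoc]

lemma sum_sign_perm_fin_three {M : Type*} [AddCommGroup M] (f : Fin 3 → Fin 3 → Fin 3 → M) :
    ∑ π : Equiv.Perm (Fin 3), (Equiv.Perm.sign π : ℤ) • f (π 0) (π 1) (π 2) =
      f 0 1 2 - f 0 2 1 - f 1 0 2 + f 1 2 0 + f 2 0 1 - f 2 1 0 := by
  have huniv : (Finset.univ : Finset (Equiv.Perm (Fin 3))) =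
      {1, Equiv.swap 1 2, Equiv.swap 0 1, Equiv.swap 0 1 * Equiv.swap 1 2,
        Equiv.swap 1 2 * Equiv.swap 0 1, Equiv.swap 0 2} := by decide
  rw [huniv, Finset.sum_insert (by decide), Finset.sum_insert (by decide),
    Finset.sum_insert (by decide), Finset.sum_insert (by decide),
    Finset.sum_insert (by decide), Finset.sum_singleton]
  simp [Equiv.swap_apply_def]
  abel

lemma derivation_half_mul (τ : Derivation K R R) (a : R) :
    τ (half K R * a) = half K R * τ a := by
  simp [half]

lemma derivation_trace_logDer (τ τ₁ τ₂ τ₃ : Derivation K R R)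
    {φ : Matrix (Fin n) (Fin n) R} (hφ : IsUnit φ) :
    τ (logDer φ τ₁ * logDer φ τ₂ * logDer φ τ₃).trace =
      (logDer₂ φ τ τ₁ * logDer φ τ₂ * logDer φ τ₃).trace
      + (logDer₂ φ τ τ₂ * logDer φ τ₃ * logDer φ τ₁).trace
      + (logDer₂ φ τ τ₃ * logDer φ τ₁ * logDer φ τ₂).trace
      - (logDer φ τ * logDer φ τ₁ * logDer φ τ₂ * logDer φ τ₃).trace
      - (logDer φ τ * logDer φ τ₂ * logDer φ τ₃ * logDer φ τ₁).trace
      - (logDer φ τ * logDer φ τ₃ * logDer φ τ₁ * logDer φ τ₂).trace := by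
  rw [trace_dmat, dmat_mul, dmat_mul, dmat_logDer τ τ₁ hφ, dmat_logDer τ τ₂ hφ,
    dmat_logDer τ τ₃ hφ]
  simp only [add_mul, sub_mul, mul_sub, Matrix.trace_add, Matrix.trace_sub, ← Matrix.mul_assoc]
  rw [trace_rotate_three (logDer₂ φ τ τ₃), trace_rotate_three (logDer φ τ₁) (logDer₂ φ τ τ₂),
    trace_rotate_four (logDer φ τ₁) (logDer φ τ),
    trace_rotate_four (logDer φ τ) (logDer φ τ₃), trace_rotate_four (logDer φ τ₃)]
  ring

end

section

variable {k A} {n : ℕ}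

lemma p3_eq (φ : Matrix (Fin n) (Fin n) A) (τ₁ τ₂ τ₃ : Derivation k A A) :
    p3 k A φ τ₁ τ₂ τ₃ = half k A * ((logDer φ τ₁ * logDer φ τ₂ * logDer φ τ₃).trace
      - (logDer φ τ₁ * logDer φ τ₃ * logDer φ τ₂).trace) := by
  have hc : half k A = 3 * algebraMap k A 6⁻¹ := by
    rw [half, ← map_ofNat (algebraMap k A) 3, ← map_mul]
    congr 1
    norm_num
  rw [p3, sum_sign_perm_fin_three fun a b c =>
    Matrix.trace ((φ⁻¹ * dmat k A (![τ₁, τ₂, τ₃] a) φ) *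
      (φ⁻¹ * dmat k A (![τ₁, τ₂, τ₃] b) φ) * (φ⁻¹ * dmat k A (![τ₁, τ₂, τ₃] c) φ)), hc]
  simp only [Matrix.cons_val, ← logDer.eq_1]
  rw [trace_rotate_three (logDer φ τ₂) (logDer φ τ₃), trace_rotate_three (logDer φ τ₃) (logDer φ τ₁),
    trace_rotate_three (logDer φ τ₃) (logDer φ τ₂), trace_rotate_three (logDer φ τ₂) (logDer φ τ₁)]
  ring

lemma p3_lie (φ : Matrix (Fin n) (Fin n) A) (τ σ τ₂ τ₃ : Derivation k A A) :
    p3 k A φ ⁅τ, σ⁆ τ₂ τ₃ = half k A *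
      ((logDer₂ φ τ σ * logDer φ τ₂ * logDer φ τ₃).trace
      - (logDer₂ φ σ τ * logDer φ τ₂ * logDer φ τ₃).trace
      - (logDer₂ φ τ σ * logDer φ τ₃ * logDer φ τ₂).trace
      + (logDer₂ φ σ τ * logDer φ τ₃ * logDer φ τ₂).trace) := by
  simp only [p3_eq, logDer_lie, sub_mul, Matrix.trace_sub]
  ring

end

/-- Section 3.5: the 3-form `(1/6)tr{(φ⁻¹dφ)³}` is closed, `d_DR p₃(φ) = 0`,
with the de Rham differential given by the Chevalley–Eilenberg formula. -/
theorem p3_closed {n : ℕ} (hn : 0 < n)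
    (φ : Matrix (Fin n) (Fin n) A) (hφ : IsUnit φ)
    (τ₀ τ₁ τ₂ τ₃ : Derivation k A A) :
    τ₀ (p3 k A φ τ₁ τ₂ τ₃) - τ₁ (p3 k A φ τ₀ τ₂ τ₃) + τ₂ (p3 k A φ τ₀ τ₁ τ₃)
        - τ₃ (p3 k A φ τ₀ τ₁ τ₂)
        - p3 k A φ ⁅τ₀, τ₁⁆ τ₂ τ₃ + p3 k A φ ⁅τ₀, τ₂⁆ τ₁ τ₃ - p3 k A φ ⁅τ₀, τ₃⁆ τ₁ τ₂
        - p3 k A φ ⁅τ₁, τ₂⁆ τ₀ τ₃ + p3 k A φ ⁅τ₁, τ₃⁆ τ₀ τ₂ - p3 k A φ ⁅τ₂, τ₃⁆ τ₀ τ₁ = 0 := by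
  rw [p3_eq φ τ₁ τ₂ τ₃, p3_eq φ τ₀ τ₂ τ₃, p3_eq φ τ₀ τ₁ τ₃, p3_eq φ τ₀ τ₁ τ₂]
  simp only [p3_lie, derivation_half_mul, map_sub, derivation_trace_logDer _ _ _ _ hφ]
  simp only [trace_rotate_four (logDer φ τ₁), trace_rotate_four (logDer φ τ₂),
    trace_rotate_four (logDer φ τ₃)]
  ring
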